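/- arXiv:1906.06259 — 2 statements merged into one kernel-verified Lean document; each statement's English description precedes it below -/
import Mathlib

section
/- Let t = 2l + 1 with l an odd positive integer, and let D_t be the graph consisting of a ladder with t squares together with one pendant edge extending the bottom path on the left and one pendant edge extending the top path on the right: vertices a_1, ..., a_{t+2} and b_0, ..., b_{t+1}, with edges a_i a_{i+1} for 1 ≤ i ≤ t+1, edges b_i b_{i+1} for 0 ≤ i ≤ t, and rungs a_i b_i for 1 ≤ i ≤ t+1. Then the edge ideal I(D_t) satisfies reg(I(D_t)) ≤ (t+3)/2. -/
/-- The faces of cardinality `m` of a simplicial complex, given as a finite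
family of finite subsets of `Fin n`. -/
def cfaces {n : ℕ} (Δ : Finset (Finset (Fin n))) (m : ℕ) : Finset (Finset (Fin n)) :=
  Δ.filter (fun F => F.card = m)

/-- The coefficient of the face `G` in the simplicial boundary of the face `F`
(with respect to the linear order on the vertices `Fin n`). -/
noncomputable def bcoeff (K : Type*) [Field K] {n : ℕ} (F G : Finset (Fin n)) : K :=
  ∑ v ∈ F, if F.erase v = G then (-1 : K) ^ (F.filter (fun w => w < v)).card else 0

/-- The simplicial boundary map from chains spanned by faces of cardinality `m+1`
to chains spanned by faces of cardinality `m` (so the augmentation map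
corresponds to `m = 0`). -/
noncomputable def boundaryMap (K : Type*) [Field K] {n : ℕ}
    (Δ : Finset (Finset (Fin n))) (m : ℕ) :
    ({F // F ∈ cfaces Δ (m + 1)} → K) →ₗ[K] ({G // G ∈ cfaces Δ m} → K) :=
  LinearMap.pi fun G => ∑ F : {F // F ∈ cfaces Δ (m + 1)}, bcoeff K F.1 G.1 • LinearMap.proj F

/-- The dimension over `K` of the `i`-th reduced simplicial homology of the
simplicial complex `Δ` (using the augmented chain complex, so that
`i = -1` is allowed). -/
noncomputable def reducedHomologyRank (K : Type*) [Field K] {n : ℕ}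
    (Δ : Finset (Finset (Fin n))) (i : ℤ) : ℕ :=
  if i = -1 then
    Module.finrank K (({F // F ∈ cfaces Δ 0} → K) ⧸ LinearMap.range (boundaryMap K Δ 0))
  else if 0 ≤ i then
    Module.finrank K
      (↥(LinearMap.ker (boundaryMap K Δ i.toNat)) ⧸
        Submodule.comap (LinearMap.ker (boundaryMap K Δ i.toNat)).subtype
          (LinearMap.range (boundaryMap K Δ (i.toNat + 1))))
  else 0

/-- The graded Betti numbers `β_{i,j}` of the Stanley–Reisner ideal of the
simplicial complex `Δ` over the field `K`, defined via Hochster's formula: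
`β_{i,j} = ∑_{|W| = j} dim_K H̃_{j-i-2}(Δ_W; K)`. -/
noncomputable def bettiNumber (K : Type*) [Field K] {n : ℕ}
    (Δ : Finset (Finset (Fin n))) (i j : ℕ) : ℕ :=
  ∑ W ∈ Finset.powersetCard j (Finset.univ : Finset (Fin n)),
    reducedHomologyRank K (Δ.filter (fun F => F ⊆ W)) ((j : ℤ) - (i : ℤ) - 2)

/-- The Castelnuovo–Mumford regularity `reg(I) = max { j - i | β_{i,j}(I) ≠ 0 }`
of the Stanley–Reisner ideal of `Δ` over `K`. -/
noncomputable def regSR (K : Type*) [Field K] {n : ℕ} (Δ : Finset (Finset (Fin n))) : ℕ :=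
  sSup {d : ℕ | ∃ i j : ℕ, bettiNumber K Δ i j ≠ 0 ∧ (j : ℤ) - (i : ℤ) = d}

/-- The projective dimension `pd(I) = max { i | β_{i,j}(I) ≠ 0 for some j }`
of the Stanley–Reisner ideal of `Δ` over `K`. -/
noncomputable def pdSR (K : Type*) [Field K] {n : ℕ} (Δ : Finset (Finset (Fin n))) : ℕ :=
  sSup {i : ℕ | ∃ j : ℕ, bettiNumber K Δ i j ≠ 0}

/-- The reduced Euler characteristic `χ̃(Δ) = ∑_{F ∈ Δ} (-1)^{|F| - 1}`
of a simplicial complex `Δ` (the alternating sum of the `f`-vector). -/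
def eulerCharSR {n : ℕ} (Δ : Finset (Finset (Fin n))) : ℤ :=
  ∑ F ∈ Δ, (-1 : ℤ) ^ (F.card + 1)

/-- The circulant graph `C_n(S)`: the graph on the vertex set `ZMod n`
(identified with `{x_1, …, x_n}`) in which `x` and `y` are adjacent if and only
if they differ by `±s (mod n)` for some `s ∈ S`. -/
def circulant (n : ℕ) (S : Set ℕ) : SimpleGraph (ZMod n) :=
  SimpleGraph.fromRel (fun x y => ∃ s ∈ S, y - x = (s : ZMod n))

/-- A graph is chordal if it has no induced cycle of length `m ≥ 4`.  Here an
induced `m`-cycle is an injection of the cycle `C_m = C_m(1)` whose image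
induces exactly the cycle's adjacency. -/
def IsChordal {V : Type*} (G : SimpleGraph V) : Prop :=
  ∀ m : ℕ, 4 ≤ m → ¬ ∃ f : ZMod m → V, Function.Injective f ∧
    ∀ a b : ZMod m, G.Adj (f a) (f b) ↔ (circulant m {1}).Adj a b

/-- A graph is claw-free if it has no induced subgraph isomorphic to the claw
`K_{1,3}`, i.e. there is no vertex adjacent to three pairwise non-adjacent
vertices. -/
def ClawFree {V : Type*} (G : SimpleGraph V) : Prop :=
  ¬ ∃ c x y z : V, x ≠ y ∧ x ≠ z ∧ y ≠ z ∧
    G.Adj c x ∧ G.Adj c y ∧ G.Adj c z ∧ ¬ G.Adj x y ∧ ¬ G.Adj x z ∧ ¬ G.Adj y z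

open Classical in
/-- The independence complex `Ind(G)` of a finite simple graph `G`, recorded
as a simplicial complex on `Fin (card V)` via a fixed identification of the
vertices with `Fin (card V)`.  It is the Stanley–Reisner complex of the edge
ideal `I(G)`. -/
noncomputable def indComplex {V : Type*} [Fintype V] (G : SimpleGraph V) :
    Finset (Finset (Fin (Fintype.card V))) :=
  Finset.univ.filter (fun F : Finset (Fin (Fintype.card V)) =>
    ∀ u ∈ F, ∀ v ∈ F,
      ¬ G.Adj ((Fintype.equivFin V).symm u) ((Fintype.equivFin V).symm v))

/-- The Castelnuovo–Mumford regularity `reg(I(G))` of the edge ideal of the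
finite simple graph `G` over the field `K`, computed (via Hochster's formula)
from the independence complex of `G`. -/
noncomputable def regEdgeIdeal (K : Type*) [Field K] {V : Type*} [Fintype V]
    (G : SimpleGraph V) : ℕ :=
  regSR K (indComplex G)

/-- The projective dimension `pd(I(G))` of the edge ideal of the finite simple
graph `G` over the field `K`, computed (via Hochster's formula) from the
independence complex of `G`. -/
noncomputable def pdEdgeIdeal (K : Type*) [Field K] {V : Type*} [Fintype V]
    (G : SimpleGraph V) : ℕ :=
  pdSR K (indComplex G)

/-- The graph `A_t`: a ladder with `t` squares together with a pendant edge
extending each of the two horizontal paths at one end.  The vertices are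
`a_0, …, a_{t+1}` (the row `(true, i) = a_i`) and `b_0, …, b_{t+1}` (the row
`(false, i) = b_i`), with edges `a_i a_{i+1}` and `b_i b_{i+1}` for
`0 ≤ i ≤ t`, and rungs `a_i b_i` for `1 ≤ i ≤ t+1`. -/
def graphA (t : ℕ) : SimpleGraph (Bool × Fin (t + 2)) :=
  SimpleGraph.fromRel (fun x y =>
    (x.1 = y.1 ∧ (y.2 : ℕ) = (x.2 : ℕ) + 1) ∨
    (x.2 = y.2 ∧ 1 ≤ (x.2 : ℕ) ∧ x.1 ≠ y.1))

/-- The ladder graph `B_t` with `t` squares: vertices `a_1, …, a_{t+1}` (the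
row `(true, i) = a_{i+1}`) and `b_1, …, b_{t+1}` (the row
`(false, i) = b_{i+1}`), with edges `a_i a_{i+1}` and `b_i b_{i+1}` for
`1 ≤ i ≤ t`, and rungs `a_i b_i` for `1 ≤ i ≤ t+1`. -/
def graphB (t : ℕ) : SimpleGraph (Bool × Fin (t + 1)) :=
  SimpleGraph.fromRel (fun x y =>
    (x.1 = y.1 ∧ (y.2 : ℕ) = (x.2 : ℕ) + 1) ∨
    (x.2 = y.2 ∧ x.1 ≠ y.1))

/-- The graph `D_t`: a ladder with `t` squares together with one pendant edge
extending the bottom path on the left and one pendant edge extending the top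
path on the right.  The vertices are `a_1, …, a_{t+2}` (the top row
`(true, i) = a_{i+1}`) and `b_0, …, b_{t+1}` (the bottom row
`(false, i) = b_i`), with edges `a_i a_{i+1}` for `1 ≤ i ≤ t+1`, edges
`b_i b_{i+1}` for `0 ≤ i ≤ t`, and rungs `a_i b_i` for `1 ≤ i ≤ t+1`. -/
def graphD (t : ℕ) : SimpleGraph (Bool × Fin (t + 2)) :=
  SimpleGraph.fromRel (fun x y =>
    (y.2 : ℕ) = (x.2 : ℕ) + 1 ∧ (x.1 = y.1 ∨ (x.1 = true ∧ y.1 = false)))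

namespace StanleyReisner

variable {K : Type*} [Field K] {n : ℕ}

/-- The sign of the vertex `v` relative to the face `F`. -/
def sgn (K : Type*) [Field K] {n : ℕ} (v : Fin n) (F : Finset (Fin n)) : K :=
  (-1) ^ (F.filter (fun w => w < v)).card

theorem sgn_mul_self (v : Fin n) (F : Finset (Fin n)) : sgn K v F * sgn K v F = 1 := by
  rw [sgn, ← mul_pow]; simp

theorem sgn_insert_self (v : Fin n) (F : Finset (Fin n)) : sgn K v (insert v F) = sgn K v F := by
  simp [sgn, Finset.filter_insert]

theorem sgn_insert_of_lt {u v : Fin n} {F : Finset (Fin n)} (hu : u ∉ F) (h : u < v) :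
    sgn K v (insert u F) = -sgn K v F := by
  simp [sgn, Finset.filter_insert, h, hu, pow_succ]

theorem sgn_insert_of_gt {u v : Fin n} {F : Finset (Fin n)} (h : v < u) :
    sgn K v (insert u F) = sgn K v F := by
  simp [sgn, Finset.filter_insert, h.not_gt]

theorem sgn_mul_sgn_insert {u v : Fin n} {F : Finset (Fin n)} (huv : u ≠ v)
    (hu : u ∉ F) (hv : v ∉ F) :
    sgn K u F * sgn K v (insert u F) = -(sgn K v F * sgn K u (insert v F)) := by
  rcases lt_or_gt_of_ne huv with h | h
  · rw [sgn_insert_of_lt hu h, sgn_insert_of_gt h]; ring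
  · rw [sgn_insert_of_lt hv h, sgn_insert_of_gt h]; ring

/-- Contraction of a chain by the vertex `v`. -/
def contract (v : Fin n) (f : Finset (Fin n) → K) (F : Finset (Fin n)) : K :=
  if v ∈ F then 0 else sgn K v F * f (insert v F)

/-- Exterior multiplication of a chain by the vertex `v`. -/
def wedge (v : Fin n) (f : Finset (Fin n) → K) (F : Finset (Fin n)) : K :=
  if v ∈ F then sgn K v F * f (F.erase v) else 0

/-- The simplicial boundary of a chain in the full simplex. -/
def bd (f : Finset (Fin n) → K) (F : Finset (Fin n)) : K := ∑ v, contract v f F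

theorem contract_contract {u v : Fin n} (huv : u ≠ v) (f : Finset (Fin n) → K)
    (F : Finset (Fin n)) : contract u (contract v f) F = -contract v (contract u f) F := by
  by_cases hu : u ∈ F
  · simp [contract, hu]
  by_cases hv : v ∈ F
  · simp [contract, hv]
  simp only [contract, hu, hv, Finset.mem_insert, huv, huv.symm, if_false, or_self,
    Finset.insert_comm v u, ← mul_assoc, sgn_mul_sgn_insert huv hu hv, neg_mul]

theorem contract_wedge {u v : Fin n} (huv : u ≠ v) (f : Finset (Fin n) → K)
    (F : Finset (Fin n)) : contract u (wedge v f) F = -wedge v (contract u f) F := by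
  by_cases hu : u ∈ F
  · simp [contract, wedge, hu, huv]
  by_cases hv : v ∈ F
  · obtain ⟨G, hG, rfl⟩ : ∃ G, v ∉ G ∧ insert v G = F :=
      ⟨F.erase v, by simp, Finset.insert_erase hv⟩
    have hu' : u ∉ G := fun h => hu (Finset.mem_insert_of_mem h)
    have h1 : (insert u (insert v G)).erase v = insert u G := by
      rw [Finset.insert_comm, Finset.erase_insert]
      simp [hG, huv.symm]
    have h2 : sgn K v (insert u (insert v G)) = sgn K v (insert u G) := by
      rw [Finset.insert_comm, sgn_insert_self]
    have h3 := sgn_mul_sgn_insert (K := K) huv hu' hG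
    have h4 := sgn_mul_self (K := K) v G
    have h5 := sgn_mul_self (K := K) v (insert u G)
    simp only [contract, wedge, hu, hu', Finset.mem_insert, true_or, or_true, if_true, if_false,
      h1, h2, sgn_insert_self, Finset.erase_insert hG]
    have h6 : sgn K u (insert v G) * sgn K v (insert u G) = -(sgn K v G * sgn K u G) := by
      linear_combination sgn K v (insert u G) * sgn K v G * h3 -
        sgn K u (insert v G) * sgn K v (insert u G) * h4 - sgn K u G * sgn K v G * h5
    linear_combination f (insert u G) * h6
  · simp [contract, wedge, hu, hv, huv.symm]

theorem contract_wedge_self_add (v : Fin n) (f : Finset (Fin n) → K) (F : Finset (Fin n)) :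
    contract v (wedge v f) F + wedge v (contract v f) F = f F := by
  by_cases hv : v ∈ F
  · obtain ⟨G, hG, rfl⟩ : ∃ G, v ∉ G ∧ insert v G = F :=
      ⟨F.erase v, by simp, Finset.insert_erase hv⟩
    simp [contract, wedge, hG, sgn_insert_self, ← mul_assoc, sgn_mul_self]
  · simp [contract, wedge, hv, sgn_insert_self, ← mul_assoc, sgn_mul_self]

theorem contract_bd (v : Fin n) (f : Finset (Fin n) → K) (F : Finset (Fin n)) :
    contract v (bd f) F = ∑ u, contract v (contract u f) F := by
  by_cases hv : v ∈ F <;> simp [contract, bd, hv, Finset.mul_sum]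

theorem wedge_bd (v : Fin n) (f : Finset (Fin n) → K) (F : Finset (Fin n)) :
    wedge v (bd f) F = ∑ u, wedge v (contract u f) F := by
  by_cases hv : v ∈ F <;> simp [wedge, bd, hv, Finset.mul_sum]

theorem bd_contract (v : Fin n) (f : Finset (Fin n) → K) (F : Finset (Fin n)) :
    bd (contract v f) F = -contract v (bd f) F := by
  rw [contract_bd, bd, ← Finset.sum_neg_distrib]
  refine Finset.sum_congr rfl fun u _ => ?_
  by_cases h : u = v
  · subst h; simp [contract]
  · exact contract_contract h f F

theorem bd_wedge (v : Fin n) (f : Finset (Fin n) → K) (F : Finset (Fin n)) :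
    bd (wedge v f) F = f F - wedge v (bd f) F := by
  rw [eq_sub_iff_add_eq, wedge_bd, bd, ← Finset.sum_add_distrib,
    Finset.sum_eq_single v _ (by simp), contract_wedge_self_add]
  intro u _ h
  rw [contract_wedge h, neg_add_cancel]

theorem bd_add (f g : Finset (Fin n) → K) (F : Finset (Fin n)) :
    bd (f + g) F = bd f F + bd g F := by
  rw [bd, bd, bd, ← Finset.sum_add_distrib]
  refine Finset.sum_congr rfl fun u _ => ?_
  by_cases h : u ∈ F <;> simp [contract, h, mul_add]

theorem bd_sub (f g : Finset (Fin n) → K) (F : Finset (Fin n)) :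
    bd (f - g) F = bd f F - bd g F := by
  rw [bd, bd, bd, ← Finset.sum_sub_distrib]
  refine Finset.sum_congr rfl fun u _ => ?_
  by_cases h : u ∈ F <;> simp [contract, h, mul_sub]

/-- The chain `f` is supported on the faces of `Δ` of cardinality `m`. -/
def SupportedOn (Δ : Finset (Finset (Fin n))) (m : ℕ) (f : Finset (Fin n) → K) : Prop :=
  ∀ F, f F ≠ 0 → F ∈ cfaces Δ m

/-- Every cycle of `Δ` on faces of cardinality `m` is a boundary in `Δ`; that is, the reduced
homology of `Δ` vanishes in degree `m - 1`. -/
def HomologyVanishes (K : Type*) [Field K] {n : ℕ} (Δ : Finset (Finset (Fin n))) (m : ℕ) : Prop :=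
  ∀ f : Finset (Fin n) → K, SupportedOn Δ m f → bd f = 0 →
    ∃ g, SupportedOn Δ (m + 1) g ∧ bd g = f

theorem homologyVanishes_of_cone {Δ : Finset (Finset (Fin n))} (v : Fin n)
    (hv : ∀ F ∈ Δ, insert v F ∈ Δ) (m : ℕ) : HomologyVanishes K Δ m := by
  intro f hf hbd
  refine ⟨wedge v f, fun F hF => ?_, funext fun F => ?_⟩
  · have hvF : v ∈ F := by
      by_contra h
      simp [wedge, h] at hF
    have h := hf (F.erase v) (fun h => hF (by simp [wedge, h]))
    simp only [cfaces, Finset.mem_filter] at h ⊢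
    refine ⟨Finset.insert_erase hvF ▸ hv _ h.1, ?_⟩
    rw [← h.2, Finset.card_erase_add_one hvF]
  · rw [bd_wedge, hbd]
    simp [wedge]

theorem homologyVanishes_of_deletion_of_link {Δ del link : Finset (Finset (Fin n))} (v : Fin n)
    (hdel : ∀ F, F ∈ del ↔ v ∉ F ∧ F ∈ Δ) (hlink : ∀ F, F ∈ link ↔ v ∉ F ∧ insert v F ∈ Δ)
    (hΔ : ∀ F, v ∉ F → insert v F ∈ Δ → F ∈ Δ) {m : ℕ}
    (h1 : HomologyVanishes K del (m + 1)) (h2 : HomologyVanishes K link m) :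
    HomologyVanishes K Δ (m + 1) := by
  intro f hf hbd
  obtain ⟨g, hg, hgf⟩ := h2 (contract v f) (fun F hF => by
      have hvF : v ∉ F := fun h => hF (by simp [contract, h])
      have h := hf (insert v F) (fun h => hF (by simp [contract, h]))
      simp only [cfaces, Finset.mem_filter, hlink, Finset.card_insert_of_notMem hvF] at h ⊢
      exact ⟨⟨hvF, h.1⟩, by omega⟩)
    (funext fun F => by rw [bd_contract, hbd]; simp [contract])
  have hwc : ∀ F, bd (wedge v (contract v f)) F = contract v f F := fun F => by
    rw [bd_wedge]
    have : bd (contract v f) = 0 := by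
      funext F; rw [bd_contract, hbd]; simp [contract]
    simp [this, wedge]
  obtain ⟨k, hk, hkf⟩ := h1 (f + g - wedge v (contract v f)) (fun F hF => by
      by_cases hvF : v ∈ F
      · have h0 : g F = 0 := by
          by_contra h
          have := hg F h
          simp [cfaces, hlink, hvF] at this
        refine absurd ?_ hF
        have := contract_wedge_self_add v f F
        simp only [contract, hvF, if_true, zero_add] at this
        simp only [Pi.sub_apply, Pi.add_apply, h0]
        rw [← this]; simp
      · have hw : wedge v (contract v f) F = 0 := by simp [wedge, hvF]
        simp only [Pi.sub_apply, Pi.add_apply, hw, sub_zero] at hF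
        by_cases h : f F = 0
        · have := hg F (by simpa [h] using hF)
          simp only [cfaces, Finset.mem_filter, hlink, hdel] at this ⊢
          exact ⟨⟨hvF, hΔ F hvF this.1.2⟩, this.2⟩
        · have := hf F h
          simp only [cfaces, Finset.mem_filter, hdel] at this ⊢
          exact ⟨⟨hvF, this.1⟩, this.2⟩)
    (funext fun F => by rw [bd_sub, bd_add, hwc, hbd, hgf]; simp)
  refine ⟨k - wedge v g, fun F hF => ?_, funext fun F => ?_⟩
  · by_cases h : k F = 0
    · have hw : wedge v g F ≠ 0 := by simpa [h] using hF
      have hvF : v ∈ F := by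
        by_contra h
        simp [wedge, h] at hw
      have := hg (F.erase v) (fun h => hw (by simp [wedge, h]))
      simp only [cfaces, Finset.mem_filter, hlink, Finset.insert_erase hvF] at this ⊢
      exact ⟨this.1.2, by rw [← this.2, Finset.card_erase_add_one hvF]⟩
    · have := hk F h
      simp only [cfaces, Finset.mem_filter, hdel] at this ⊢
      exact ⟨this.1.2, this.2⟩
  · rw [bd_sub, hkf, bd_wedge, hgf]
    simp

theorem sum_bcoeff_mul (f : Finset (Fin n) → K) (G : Finset (Fin n)) :
    ∑ F, bcoeff K F G * f F = bd f G := by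
  have h : ∀ F : Finset (Fin n), bcoeff K F G * f F =
      ∑ v, if v ∈ F ∧ F.erase v = G then sgn K v F * f F else 0 := by
    intro F
    rw [bcoeff, Finset.sum_mul, ← Finset.sum_filter_add_sum_filter_not Finset.univ (· ∈ F)]
    rw [Finset.sum_eq_zero (s := Finset.univ.filter (· ∉ F)), add_zero]
    · refine Finset.sum_congr (by simp) fun v hv => ?_
      simp [(Finset.mem_filter.1 hv).2, sgn, ite_mul]
    · intro v hv
      simp only [Finset.mem_filter] at hv
      simp [hv.2]
  simp_rw [h]
  rw [Finset.sum_comm, bd]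
  refine Finset.sum_congr rfl fun v _ => ?_
  by_cases hv : v ∈ G
  · rw [Finset.sum_eq_zero, contract, if_pos hv]
    rintro F -
    rw [if_neg]
    rintro ⟨-, rfl⟩
    simp at hv
  · rw [Finset.sum_eq_single (insert v G) _ (by simp), if_pos (by simp [hv]), contract,
      if_neg hv, sgn_insert_self]
    rintro F - hF
    rw [if_neg]
    rintro ⟨h1, rfl⟩
    exact hF (Finset.insert_erase h1).symm

theorem boundaryMap_apply {Δ : Finset (Finset (Fin n))} {m : ℕ} {f : Finset (Fin n) → K}
    (hf : SupportedOn Δ (m + 1) f) (G : {G // G ∈ cfaces Δ m}) :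
    boundaryMap K Δ m (fun F => f F.1) G = bd f G.1 := by
  rw [← sum_bcoeff_mul]
  simp only [boundaryMap, LinearMap.pi_apply, LinearMap.sum_apply, LinearMap.smul_apply,
    LinearMap.proj_apply, smul_eq_mul]
  rw [Finset.sum_coe_sort (cfaces Δ (m + 1)) (fun F => bcoeff K F G.1 * f F)]
  refine Finset.sum_subset (Finset.subset_univ _) fun F _ hF => ?_
  rw [not_not.1 (mt (hf F) hF), mul_zero]

theorem bd_eq_zero_of_notMem {Δ : Finset (Finset (Fin n))} (hΔ : ∀ F ∈ Δ, ∀ G ⊆ F, G ∈ Δ)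
    {m : ℕ} {f : Finset (Fin n) → K} (hf : SupportedOn Δ (m + 1) f) {G : Finset (Fin n)}
    (hG : G ∉ cfaces Δ m) : bd f G = 0 := by
  refine Finset.sum_eq_zero fun v _ => ?_
  by_cases hv : v ∈ G
  · simp [contract, hv]
  · have : f (insert v G) = 0 := by
      by_contra h
      have := hf _ h
      simp only [cfaces, Finset.mem_filter, Finset.card_insert_of_notMem hv] at this hG
      exact hG ⟨hΔ _ this.1 _ (Finset.subset_insert _ _), by omega⟩
    simp [contract, this]

theorem reducedHomologyRank_eq_zero {Δ : Finset (Finset (Fin n))}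
    (hΔ : ∀ F ∈ Δ, ∀ G ⊆ F, G ∈ Δ) {m : ℕ} (h : HomologyVanishes K Δ (m + 1)) :
    reducedHomologyRank K Δ m = 0 := by
  classical
  rw [reducedHomologyRank, if_neg (by omega), if_pos (by omega), Int.toNat_natCast]
  have htop : Submodule.comap (LinearMap.ker (boundaryMap K Δ m)).subtype
      (LinearMap.range (boundaryMap K Δ (m + 1))) = ⊤ := by
    rw [eq_top_iff]
    rintro ⟨f, hf⟩ -
    rw [LinearMap.mem_ker] at hf
    let f' : Finset (Fin n) → K := fun F => if hF : F ∈ cfaces Δ (m + 1) then f ⟨F, hF⟩ else 0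
    have hf' : SupportedOn Δ (m + 1) f' := fun F hF => by
      by_contra h
      exact hF (by simp [f', h])
    have hff' : (fun F : {F // F ∈ cfaces Δ (m + 1)} => f' F.1) = f := by
      funext F
      simp [f', F.2]
    obtain ⟨g, hg, hgf⟩ := h f' hf' (funext fun G => by
      by_cases hG : G ∈ cfaces Δ m
      · rw [← boundaryMap_apply hf' ⟨G, hG⟩, hff', hf]; rfl
      · exact bd_eq_zero_of_notMem hΔ hf' hG)
    refine ⟨fun F => g F.1, funext fun G => ?_⟩
    rw [boundaryMap_apply hg, hgf]
    exact congrFun hff' G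
  rw [htop]
  exact Module.finrank_zero_of_subsingleton

section Graph

variable {V : Type*} [Fintype V] {G : SimpleGraph V}

/-- The reduced homology of the independence complex of every induced subgraph of `G` on a
subset of `S` vanishes in degrees at least `m`. -/
def RegLE (K : Type*) [Field K] {V : Type*} [Fintype V] (G : SimpleGraph V) (S : Set V)
    (m : ℕ) : Prop :=
  ∀ W : Finset (Fin (Fintype.card V)), (∀ i ∈ W, (Fintype.equivFin V).symm i ∈ S) →
    ∀ k, m ≤ k → HomologyVanishes K ((indComplex G).filter (· ⊆ W)) (k + 1)

theorem mem_indComplex_filter {F W : Finset (Fin (Fintype.card V))} :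
    F ∈ (indComplex G).filter (· ⊆ W) ↔
      (∀ u ∈ F, ∀ v ∈ F,
        ¬ G.Adj ((Fintype.equivFin V).symm u) ((Fintype.equivFin V).symm v)) ∧ F ⊆ W := by
  simp [indComplex]

theorem mem_indComplex_filter_of_subset {F F' W : Finset (Fin (Fintype.card V))}
    (hF : F ∈ (indComplex G).filter (· ⊆ W)) (h : F' ⊆ F) :
    F' ∈ (indComplex G).filter (· ⊆ W) := by
  rw [mem_indComplex_filter] at hF ⊢
  exact ⟨fun u hu v hv => hF.1 u (h hu) v (h hv), h.trans hF.2⟩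

theorem RegLE.mono {S T : Set V} {m : ℕ} (h : RegLE K G T m) (hST : S ⊆ T) : RegLE K G S m :=
  fun W hW => h W fun i hi => hST (hW i hi)

theorem RegLE.mono_right {S : Set V} {m m' : ℕ} (h : RegLE K G S m) (hm : m ≤ m') :
    RegLE K G S m' :=
  fun W hW k hk => h W hW k (hm.trans hk)

theorem regLE_empty (m : ℕ) : RegLE K G ∅ m := by
  intro W hW k _ f hf _
  have hW0 : W = ∅ := Finset.eq_empty_of_forall_notMem fun i hi => hW i hi
  have hf0 : f = 0 := funext fun F => by
    by_contra h
    have hF := Finset.mem_filter.1 (hf F h)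
    have hFW := (mem_indComplex_filter.1 hF.1).2
    rw [hW0, Finset.subset_empty] at hFW
    simp [hFW] at hF
  refine ⟨0, fun F hF => absurd rfl hF, ?_⟩
  rw [hf0]
  funext F
  simp [bd, contract]

/-- Isolated vertices do not contribute to the regularity. -/
theorem RegLE.of_isolated {S T : Set V} {m : ℕ} (v : V) (h : RegLE K G T m)
    (hST : ∀ x ∈ S, x ≠ v → x ∈ T) (hv : ∀ x ∈ S, ¬ G.Adj v x) : RegLE K G S m := by
  intro W hW
  set e := Fintype.equivFin V
  by_cases hvW : e v ∈ W
  · intro k _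
    refine homologyVanishes_of_cone (e v) (fun F hF => ?_) _
    rw [mem_indComplex_filter] at hF ⊢
    refine ⟨fun a ha b hb hab => ?_, Finset.insert_subset hvW hF.2⟩
    have hvF : ∀ c ∈ F, ¬ G.Adj v (e.symm c) := fun c hc => hv _ (hW c (hF.2 hc))
    rw [Finset.mem_insert] at ha hb
    rcases ha with rfl | ha <;> rcases hb with rfl | hb
    · exact G.irrefl hab
    · exact hvF b hb (by simpa [e] using hab)
    · exact hvF a ha (by simpa [e] using hab.symm)
    · exact hF.1 a ha b hb hab
  · refine h W fun i hi => hST _ (hW i hi) ?_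
    exact fun h => hvW (by simpa [← h, e] using hi)

/-- The regularity of `G` is controlled by deleting a vertex, respectively its closed
neighbourhood. -/
theorem RegLE.of_vertex {S : Set V} {m : ℕ} (v : V) (h1 : RegLE K G {x ∈ S | x ≠ v} (m + 1))
    (h2 : RegLE K G {x ∈ S | x ≠ v ∧ ¬ G.Adj v x} m) : RegLE K G S (m + 1) := by
  classical
  intro W hW k hk
  set e := Fintype.equivFin V with he
  by_cases hvW : e v ∈ W
  · obtain ⟨k, rfl⟩ : ∃ k', k = k' + 1 := ⟨k - 1, by omega⟩
    refine homologyVanishes_of_deletion_of_link (e v) ?_ ?_ ?_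
      (h1 (W.filter (· ≠ e v)) ?_ _ hk)
      (h2 (W.filter fun i => i ≠ e v ∧ ¬ G.Adj v (e.symm i)) ?_ k (by omega))
    · intro F
      rw [mem_indComplex_filter, mem_indComplex_filter]
      simp only [Finset.subset_iff, Finset.mem_filter]
      constructor
      · rintro ⟨hF, hFW⟩
        exact ⟨fun h => (hFW h).2 rfl, hF, fun x hx => (hFW hx).1⟩
      · rintro ⟨hvF, hF, hFW⟩
        exact ⟨hF, fun x hx => ⟨hFW hx, fun h => hvF (h ▸ hx)⟩⟩
    · intro F
      rw [mem_indComplex_filter, mem_indComplex_filter]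
      simp only [Finset.subset_iff, Finset.mem_filter, Finset.mem_insert]
      constructor
      · rintro ⟨hF, hFW⟩
        refine ⟨fun h => (hFW h).2.1 rfl, ?_, ?_⟩
        · rintro a (rfl | ha) b (rfl | hb) hab
          · exact G.irrefl hab
          · exact (hFW hb).2.2 (by simpa [e] using hab)
          · exact (hFW ha).2.2 (by simpa [e] using hab.symm)
          · exact hF a ha b hb hab
        · rintro x (rfl | hx)
          · exact hvW
          · exact (hFW hx).1
      · rintro ⟨hvF, hF, hFW⟩
        refine ⟨fun a ha b hb => hF a (.inr ha) b (.inr hb), fun x hx =>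
          ⟨hFW (.inr hx), fun h => hvF (h ▸ hx), fun h => ?_⟩⟩
        exact hF (e v) (.inl rfl) x (.inr hx) (by simpa [he] using h)
    · exact fun F _ hF => mem_indComplex_filter_of_subset hF (Finset.subset_insert _ _)
    · intro i hi
      rw [Finset.mem_filter] at hi
      exact ⟨hW i hi.1, fun h => hi.2 (by simp [← h, e])⟩
    · intro i hi
      rw [Finset.mem_filter] at hi
      exact ⟨hW i hi.1, fun h => hi.2.1 (by simp [← h, e]), hi.2.2⟩
  · refine h1 W (fun i hi => ⟨hW i hi, ?_⟩) k hk
    exact fun h => hvW (by simpa [← h, e] using hi)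

/-- Removing the edges of a square `x y z r` with a pendant vertex `p` attached at `x` (and
possibly further edges attached at `y`) lowers the regularity by at most one. -/
theorem RegLE.of_square {S T : Set V} {m : ℕ} (x y z p r : V) (h : RegLE K G T m)
    (hST : ∀ w ∈ S, w ∈ T ∨ w = x ∨ w = y ∨ w = z ∨ w = p ∨ w = r) (hz : z ∈ T)
    (hxy : G.Adj x y) (hxp : G.Adj x p) (hxr : G.Adj x r) (hyz : G.Adj y z) (hzr : G.Adj z r)
    (hp : ∀ w ∈ S, G.Adj p w → w = x) (hr : ∀ w ∈ S, G.Adj r w → w = x ∨ w = z) :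
    RegLE K G S (m + 1) := by
  refine .of_vertex x ?_ (h.mono ?_)
  · refine .of_isolated (T := {w ∈ S | w ≠ x ∧ w ≠ p}) p ?_ (fun w hw hwp => ⟨hw.1, hw.2, hwp⟩)
      (fun w hw hpw => hw.2 (hp w hw.1 hpw))
    refine .of_vertex y ?_ ?_
    · refine .of_vertex z ?_ (h.mono ?_)
      · refine .mono_right (.of_isolated r h ?_ ?_) m.le_succ
        · grind
        · grind
      · rintro w ⟨⟨⟨h1, h2, h3⟩, h4⟩, h5, h6⟩
        grind
    · refine .of_isolated r h ?_ ?_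
      · rintro w ⟨⟨h1, h2, h3⟩, h4, h5⟩ h6
        grind
      · rintro w ⟨⟨h1, h2, h3⟩, h4, h5⟩ h6
        grind
  · rintro w ⟨h1, h2, h3⟩
    grind

theorem regEdgeIdeal_le {m : ℕ} (h : RegLE K G Set.univ m) : regEdgeIdeal K G ≤ m + 1 := by
  refine csSup_le' ?_
  rintro d ⟨i, j, hb, hd⟩
  by_contra! hlt
  refine hb (Finset.sum_eq_zero fun W _ => ?_)
  obtain ⟨k, rfl⟩ : ∃ k, d = k + 2 := ⟨d - 2, by omega⟩
  rw [show (j : ℤ) - i - 2 = (k : ℕ) by push_cast at hd; omega]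
  exact reducedHomologyRank_eq_zero (fun F hF F' hF' => mem_indComplex_filter_of_subset hF hF')
    (h W (fun _ _ => trivial) k (by omega))

end Graph

theorem graphD_adj {t : ℕ} {x y : Bool × Fin (t + 2)} :
    (graphD t).Adj x y ↔
      ((y.2 : ℕ) = x.2 + 1 ∧ (x.1 = y.1 ∨ (x.1 = true ∧ y.1 = false))) ∨
      ((x.2 : ℕ) = y.2 + 1 ∧ (y.1 = x.1 ∨ (y.1 = true ∧ x.1 = false))) := by
  rw [graphD, SimpleGraph.fromRel_adj, and_iff_right_iff_imp]
  rintro h rfl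
  omega

theorem regLE_graphD (k q : ℕ) (t : ℕ) (ht : t = 4 * (q + k) - 1) (hk : 0 < q + k) :
    RegLE K (graphD t) {v | 4 * q ≤ (v.2 : ℕ)} (2 * k) := by
  induction k generalizing q with
  | zero =>
    refine .of_isolated (T := {v | 4 * q ≤ (v.2 : ℕ) ∧ v.1 = false})
      (true, ⟨4 * q, by omega⟩) (.of_isolated (false, ⟨4 * q, by omega⟩) (regLE_empty 0)
        ?_ ?_) ?_ ?_
    all_goals
      rintro ⟨c, i, hi⟩
      cases c <;> simp [graphD_adj] <;> omega
  | succ k ih =>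
    have h0 := ih (q + 1) (by omega) (by omega)
    have h1 : RegLE K (graphD t)
        {v | 4 * q + 1 ≤ (v.2 : ℕ) ∧ (v.1 = false → 4 * q + 3 ≤ (v.2 : ℕ))} (2 * k + 1) := by
      refine .of_square (true, ⟨4 * q + 2, by omega⟩) (true, ⟨4 * q + 3, by omega⟩)
        (false, ⟨4 * q + 4, by omega⟩) (true, ⟨4 * q + 1, by omega⟩)
        (false, ⟨4 * q + 3, by omega⟩) h0 ?_ ?_ ?_ ?_ ?_ ?_ ?_ ?_ ?_
      all_goals first
        | (simp [graphD_adj]; done)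
        | (simp [graphD_adj]; omega)
        | (rintro ⟨c, i, hi⟩; cases c <;> simp [graphD_adj] <;> omega)
    refine .of_square (false, ⟨4 * q + 1, by omega⟩) (false, ⟨4 * q + 2, by omega⟩)
      (true, ⟨4 * q + 1, by omega⟩) (false, ⟨4 * q, by omega⟩)
      (true, ⟨4 * q, by omega⟩) h1 ?_ ?_ ?_ ?_ ?_ ?_ ?_ ?_ ?_
    all_goals first
      | (simp [graphD_adj]; done)
      | (simp [graphD_adj]; omega)
      | (rintro ⟨c, i, hi⟩; cases c <;> simp [graphD_adj] <;> omega)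

end StanleyReisner

/-- **Lemma 4.2(iii).**
If `t = 2l + 1` with `l` an odd positive integer, then the edge ideal of the
graph `D_t` satisfies `reg(I(D_t)) ≤ (t+3)/2`. -/
theorem regularity_bound_graphD (K : Type*) [Field K] (t l : ℕ)
    (hl : Odd l) (hlpos : 1 ≤ l) (htl : t = 2 * l + 1) :
    regEdgeIdeal K (graphD t) ≤ (t + 3) / 2 := by
  obtain ⟨r, rfl⟩ := hl
  have h := StanleyReisner.regLE_graphD (K := K) (r + 1) 0 t (by omega) (by omega)
  refine (StanleyReisner.regEdgeIdeal_le (h.mono fun v _ => by simp)).trans ?_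
  omega
end

section
/- Let n ≥ 4 and let G = C_{2n}(1, n) be the cubic circulant graph on 2n vertices with connection set {1, n}. Then the edge ideal I(G) satisfies pd(I(G)) ≤ 3k - 1 if n = 2k, and pd(I(G)) ≤ 3k + 1 if n = 2k + 1. -/
section SplittingBound

open scoped Classical

/-- `SplittingBound G W c` says that the projective dimension of the quotient by the edge ideal of
`G[W]` is bounded by `c` via successively splitting at vertices: deleting the vertex `v` adds `1`
to the bound, deleting its closed neighbourhood adds the degree of `v`. -/
inductive SplittingBound {V : Type*} (G : SimpleGraph V) : Finset V → ℕ → Prop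
  | edgeless {W : Finset V} (c : ℕ) (h : ∀ u ∈ W, ∀ v ∈ W, ¬ G.Adj u v) : SplittingBound G W c
  | split {W : Finset V} (v : V) {a b c : ℕ}
      (hdel : SplittingBound G (W.erase v) a)
      (hlink : SplittingBound G (W.filter fun w => w ≠ v ∧ ¬ G.Adj v w) b)
      (ha : a + 1 ≤ c) (hb : b + (W.filter (G.Adj v)).card ≤ c) : SplittingBound G W c

namespace SplittingBound

variable {V : Type*} {G G₁ G₂ : SimpleGraph V} {W W' : Finset V} {c c' c₁ c₂ : ℕ}

theorem mono (h : SplittingBound G W c) (hW : W' ⊆ W) (hc : c ≤ c') : SplittingBound G W' c' := by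
  induction h generalizing W' c' with
  | edgeless c h => exact edgeless _ fun u hu v hv => h u (hW hu) v (hW hv)
  | @split W v a b c _ _ ha hb ih₁ ih₂ =>
    have hcard : (W'.filter (G.Adj v)).card ≤ (W.filter (G.Adj v)).card :=
      Finset.card_le_card (Finset.filter_subset_filter _ hW)
    refine split v (ih₁ (Finset.erase_subset_erase _ hW) le_rfl)
      (ih₂ (Finset.filter_subset_filter _ hW) le_rfl) (ha.trans hc) (by omega)

theorem congr (h : SplittingBound G₁ W c)
    (hG : ∀ u ∈ W, ∀ v ∈ W, G₁.Adj u v ↔ G₂.Adj u v) : SplittingBound G₂ W c := by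
  induction h with
  | edgeless c h => exact edgeless _ fun u hu v hv => by rw [← hG u hu v hv]; exact h u hu v hv
  | @split W v a b c h₁ h₂ ha hb ih₁ ih₂ =>
    have ih₁ := ih₁ fun u hu w hw => hG u (Finset.mem_of_mem_erase hu) w (Finset.mem_of_mem_erase hw)
    by_cases hv : v ∈ W
    · have ih₂ := ih₂ fun u hu w hw =>
        hG u (Finset.mem_of_mem_filter _ hu) w (Finset.mem_of_mem_filter _ hw)
      refine split v ih₁ (b := b) ?_ ha ?_
      · convert ih₂ using 1
        ext w
        simp only [Finset.mem_filter]
        grind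
      · convert hb using 3
        ext w
        simp only [Finset.mem_filter]
        grind
    · rw [Finset.erase_eq_of_notMem hv] at ih₁
      exact ih₁.mono subset_rfl (by omega)

theorem link (h : SplittingBound G W c) {v : V} (hv : v ∈ W) :
    ∃ b, SplittingBound G (W.filter fun w => w ≠ v ∧ ¬ G.Adj v w) b ∧
      b + (W.filter (G.Adj v)).card ≤ c := by
  induction h with
  | @edgeless W c h =>
    refine ⟨0, edgeless _ fun u hu w hw =>
      h u (Finset.mem_of_mem_filter _ hu) w (Finset.mem_of_mem_filter _ hw), ?_⟩
    rw [Finset.filter_false_of_mem fun w hw => h v hv w hw]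
    simp
  | @split W u a b c h₁ h₂ ha hb ih₁ ih₂ =>
    by_cases huv : u = v
    · subst huv
      exact ⟨b, h₂, hb⟩
    obtain ⟨a', ha', hac⟩ := ih₁ (by grind)
    by_cases hadj : G.Adj v u
    · refine ⟨a', ?_, ?_⟩
      · convert ha' using 1
        ext w
        simp only [Finset.mem_filter, Finset.mem_erase]
        grind
      · have : W.filter (G.Adj v) ⊆ insert u (((W.erase u).filter (G.Adj v))) := by
          intro w
          simp only [Finset.mem_filter, Finset.mem_insert, Finset.mem_erase]
          grind
        have := (Finset.card_le_card this).trans (Finset.card_insert_le _ _)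
        omega
    · have hadj' : ¬ G.Adj u v := fun h => hadj h.symm
      obtain ⟨b', hb', hbc⟩ := ih₂ (by simp [hv, hadj', Ne.symm huv])
      have hdel : (W.erase u).filter (G.Adj v) = W.filter (G.Adj v) := by
        ext w
        simp only [Finset.mem_filter, Finset.mem_erase]
        grind
      have e₁ : (W.filter fun w => w ≠ v ∧ ¬ G.Adj v w).filter (G.Adj u) =
          W.filter (G.Adj u) \ W.filter (G.Adj v) := by
        ext w
        simp only [Finset.mem_filter, Finset.mem_sdiff]
        grind
      have e₂ : (W.filter fun w => w ≠ u ∧ ¬ G.Adj u w).filter (G.Adj v) =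
          W.filter (G.Adj v) \ W.filter (G.Adj u) := by
        ext w
        simp only [Finset.mem_filter, Finset.mem_sdiff]
        grind
      have hcard : ((W.filter fun w => w ≠ v ∧ ¬ G.Adj v w).filter (G.Adj u)).card +
          (W.filter (G.Adj v)).card =
          ((W.filter fun w => w ≠ u ∧ ¬ G.Adj u w).filter (G.Adj v)).card +
          (W.filter (G.Adj u)).card := by
        rw [e₁, e₂, Finset.card_sdiff_add_card, Finset.card_sdiff_add_card, Finset.union_comm]
      have hac : a' + (W.filter (G.Adj v)).card ≤ a := by rwa [← hdel]
      refine ⟨c - (W.filter (G.Adj v)).card,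
        split u (a := a') (b := b') ?_ ?_ (by omega) (by omega), by omega⟩
      · convert ha' using 1
        ext w
        simp only [Finset.mem_filter, Finset.mem_erase]
        grind
      · convert hb' using 1
        ext w
        simp only [Finset.mem_filter]
        grind

theorem sup (h₁ : SplittingBound G₁ W c₁) (h₂ : SplittingBound G₂ W c₂) :
    SplittingBound (G₁ ⊔ G₂) W (c₁ + c₂) := by
  suffices H : ∀ W' ⊆ W, ∀ c₂, SplittingBound G₂ W' c₂ → SplittingBound (G₁ ⊔ G₂) W' (c₁ + c₂) from
    H W subset_rfl c₂ h₂
  clear h₂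
  induction h₁ with
  | edgeless c h =>
    intro W' hW c₂ h₂
    refine (h₂.congr fun u hu v hv => ?_).mono subset_rfl (Nat.le_add_left _ _)
    simp [h u (hW hu) v (hW hv)]
  | @split W v a b c h₁ h₁' ha hb ih₁ ih₂ =>
    intro W' hW c₂ h₂
    have hdel := ih₁ _ (Finset.erase_subset_erase v hW) _
      (h₂.mono (Finset.erase_subset _ _) le_rfl)
    by_cases hv : v ∈ W'
    · obtain ⟨b', hb', hbc⟩ := h₂.link hv
      have hfar : W'.filter (fun w => w ≠ v ∧ ¬ (G₁ ⊔ G₂).Adj v w) ⊆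
          W.filter (fun w => w ≠ v ∧ ¬ G₁.Adj v w) := by
        intro w
        simp only [Finset.mem_filter, SimpleGraph.sup_adj]
        grind
      have hfar₂ : W'.filter (fun w => w ≠ v ∧ ¬ (G₁ ⊔ G₂).Adj v w) ⊆
          W'.filter (fun w => w ≠ v ∧ ¬ G₂.Adj v w) := by
        intro w
        simp only [Finset.mem_filter, SimpleGraph.sup_adj]
        tauto
      have hcard : (W'.filter ((G₁ ⊔ G₂).Adj v)).card ≤
          (W.filter (G₁.Adj v)).card + (W'.filter (G₂.Adj v)).card := by
        refine (Finset.card_le_card ?_).trans (Finset.card_union_le _ _)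
        intro w
        simp only [Finset.mem_filter, SimpleGraph.sup_adj, Finset.mem_union]
        grind
      have hlink := ih₂ _ hfar _ (hb'.mono hfar₂ le_rfl)
      have hbound : b + b' + (W'.filter ((G₁ ⊔ G₂).Adj v)).card ≤ c + c₂ := by omega
      exact split v hdel (b := b + b') (by convert hlink) (by omega) (by convert hbound)
    · rw [Finset.erase_eq_of_notMem hv] at hdel
      exact hdel.mono subset_rfl (by omega)

/-- The `2 × 3` grid with one of its two outer rungs removed has splitting bound `3`. -/
theorem squareWithTails {a₁ a₂ a₃ b₁ b₂ b₃ : V} (hd : [a₁, a₂, a₃, b₁, b₂, b₃].Nodup)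
    (W : Finset V) :
    SplittingBound (SimpleGraph.fromEdgeSet
      {s(a₁, a₂), s(a₂, a₃), s(b₁, b₂), s(b₂, b₃), s(a₁, b₁), s(a₂, b₂)}) W 3 := by
  set G := SimpleGraph.fromEdgeSet
      {s(a₁, a₂), s(a₂, a₃), s(b₁, b₂), s(b₂, b₃), s(a₁, b₁), s(a₂, b₂)} with hG
  have hadj : ∀ x y, G.Adj x y ↔ x ≠ y ∧ (s(x, y) = s(a₁, a₂) ∨ s(x, y) = s(a₂, a₃) ∨
      s(x, y) = s(b₁, b₂) ∨ s(x, y) = s(b₂, b₃) ∨ s(x, y) = s(a₁, b₁) ∨ s(x, y) = s(a₂, b₂)) := by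
    intro x y
    simp [hG, SimpleGraph.fromEdgeSet_adj, and_comm]
  simp only [Sym2.eq_iff] at hadj
  clear_value G
  simp only [List.nodup_cons, List.mem_cons, List.not_mem_nil, or_false, not_or] at hd
  have hdeg : ∀ (W : Finset V) v (S : Finset V), (∀ w, G.Adj v w → w ∈ W → w ∈ S) →
      (W.filter (G.Adj v)).card ≤ S.card := fun W v S h =>
    Finset.card_le_card fun w hw => h w (Finset.mem_filter.1 hw).2 (Finset.mem_filter.1 hw).1
  refine split a₂ (a := 2) (b := 0) (split b₂ (a := 1) (b := 0)
    (split a₁ (a := 0) (b := 0) ?_ ?_ le_rfl ?_) ?_ le_rfl ?_) ?_ le_rfl ?_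
  · refine edgeless _ fun u hu v hv => ?_
    simp only [Finset.mem_erase] at hu hv
    grind
  · refine edgeless _ fun u hu v hv => ?_
    simp only [Finset.mem_erase, Finset.mem_filter] at hu hv
    grind
  · have := hdeg ((W.erase a₂).erase b₂) a₁ {b₁} (by grind)
    simpa using this
  · refine edgeless _ fun u hu v hv => ?_
    simp only [Finset.mem_erase, Finset.mem_filter] at hu hv
    grind
  · have := (hdeg (W.erase a₂) b₂ {b₁, b₃} (by grind)).trans Finset.card_le_two
    simpa using this
  · refine edgeless _ fun u hu v hv => ?_
    simp only [Finset.mem_filter] at hu hv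
    grind
  · have := (hdeg W a₂ {a₁, a₃, b₂} (by grind)).trans Finset.card_le_three
    simpa using this

/-- The path on four vertices has splitting bound `2`. -/
theorem path {a₁ a₂ b₁ b₂ : V} (hd : [a₁, a₂, b₁, b₂].Nodup) (W : Finset V) :
    SplittingBound (SimpleGraph.fromEdgeSet {s(a₁, a₂), s(b₁, b₂), s(a₁, b₁)}) W 2 := by
  set G := SimpleGraph.fromEdgeSet {s(a₁, a₂), s(b₁, b₂), s(a₁, b₁)} with hG
  have hadj : ∀ x y, G.Adj x y ↔ x ≠ y ∧ (s(x, y) = s(a₁, a₂) ∨ s(x, y) = s(b₁, b₂) ∨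
      s(x, y) = s(a₁, b₁)) := by
    intro x y
    simp [hG, SimpleGraph.fromEdgeSet_adj, and_comm]
  simp only [Sym2.eq_iff] at hadj
  clear_value G
  simp only [List.nodup_cons, List.mem_cons, List.not_mem_nil, or_false, not_or] at hd
  have hdeg : ∀ (W : Finset V) v (S : Finset V), (∀ w, G.Adj v w → w ∈ W → w ∈ S) →
      (W.filter (G.Adj v)).card ≤ S.card := fun W v S h =>
    Finset.card_le_card fun w hw => h w (Finset.mem_filter.1 hw).2 (Finset.mem_filter.1 hw).1
  refine split a₁ (a := 1) (b := 0) (split b₁ (a := 0) (b := 0) ?_ ?_ le_rfl ?_) ?_ le_rfl ?_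
  · refine edgeless _ fun u hu v hv => ?_
    simp only [Finset.mem_erase] at hu hv
    grind
  · refine edgeless _ fun u hu v hv => ?_
    simp only [Finset.mem_erase, Finset.mem_filter] at hu hv
    grind
  · have := hdeg (W.erase a₁) b₁ {b₂} (by grind)
    simpa using this
  · refine edgeless _ fun u hu v hv => ?_
    simp only [Finset.mem_filter] at hu hv
    grind
  · have := (hdeg W a₁ {a₂, b₁} (by grind)).trans Finset.card_le_two
    simpa using this

theorem iSup_lt {G : ℕ → SimpleGraph V} (h : ∀ j W, SplittingBound (G j) W c) (k : ℕ)
    (W : Finset V) : SplittingBound (⨆ j : ℕ, ⨆ _ : j < k, G j) W (c * k) := by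
  induction k with
  | zero => exact edgeless _ (by simp)
  | succ k ih =>
    rw [Nat.iSup_lt_succ, mul_add_one]
    exact ih.sup (h k W)

theorem comap_equiv {V' : Type*} (h : SplittingBound G W c) (e : V' ≃ V) (W' : Finset V')
    (hW : ∀ x ∈ W', e x ∈ W) : SplittingBound (G.comap e) W' c := by
  induction h generalizing W' with
  | edgeless c h => exact edgeless _ fun u hu v hv => h _ (hW u hu) _ (hW v hv)
  | @split W v a b c _ _ ha hb ih₁ ih₂ =>
    have hcard : (W'.filter ((G.comap e).Adj (e.symm v))).card ≤ (W.filter (G.Adj v)).card := by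
      refine Finset.card_le_card_of_injOn e (fun x hx => ?_) e.injective.injOn
      simp only [Finset.coe_filter, Set.mem_ofPred_eq, SimpleGraph.comap_adj,
        Equiv.apply_symm_apply] at hx ⊢
      exact ⟨hW x hx.1, hx.2⟩
    have hbound : b + (W'.filter ((G.comap e).Adj (e.symm v))).card ≤ c := by omega
    refine split (e.symm v) (ih₁ _ fun x hx => ?_) (ih₂ _ fun x hx => ?_) ha (by convert hbound)
    · rw [Finset.mem_erase] at hx ⊢
      exact ⟨fun h => hx.1 (by simp [← h]), hW x hx.2⟩
    · simp only [Finset.mem_filter, SimpleGraph.comap_adj, Equiv.apply_symm_apply] at hx ⊢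
      exact ⟨hW x hx.1, fun h => hx.2.1 (by simp [← h]), hx.2.2⟩

end SplittingBound

end SplittingBound

section ReducedHomology

variable {K : Type*} [Field K] {N : ℕ}

/-- The sign of the vertex `v` relative to the set `F`. -/
def vertexSign (K : Type*) [Field K] {N : ℕ} (v : Fin N) (F : Finset (Fin N)) : K :=
  (-1) ^ (F.filter (· < v)).card

/-- The boundary operator on chains of the full simplex, given as functions on all subsets. -/
def chainBoundary (z : Finset (Fin N) → K) (G : Finset (Fin N)) : K :=
  ∑ w ∈ Gᶜ, vertexSign K w G * z (insert w G)

/-- The cone operator joining a chain with the vertex `v`. -/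
def chainCone (v : Fin N) (z : Finset (Fin N) → K) (F : Finset (Fin N)) : K :=
  if v ∈ F then vertexSign K v F * z (F.erase v) else 0

theorem vertexSign_mul_self (v : Fin N) (F : Finset (Fin N)) :
    vertexSign K v F * vertexSign K v F = 1 := by
  rw [vertexSign, ← pow_add, ← two_mul, pow_mul]
  simp

theorem vertexSign_insert_self (v : Fin N) (F : Finset (Fin N)) :
    vertexSign K v (insert v F) = vertexSign K v F := by
  simp [vertexSign, Finset.filter_insert]

theorem vertexSign_erase_self (v : Fin N) (F : Finset (Fin N)) :
    vertexSign K v (F.erase v) = vertexSign K v F := by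
  simp [vertexSign, Finset.filter_erase]

theorem vertexSign_mul_insert {v w : Fin N} (h : v ≠ w) {F : Finset (Fin N)} (hv : v ∈ F)
    (hw : w ∉ F) : vertexSign K w F * vertexSign K v (insert w F) =
      -(vertexSign K v F * vertexSign K w (F.erase v)) := by
  simp only [vertexSign, Finset.filter_insert, Finset.filter_erase]
  rcases lt_or_gt_of_ne h with h | h
  · have hmem : v ∈ F.filter (· < w) := by simp [hv, h]
    have hcard := Finset.card_erase_add_one hmem
    rw [if_neg h.asymm, ← hcard, pow_succ]
    ring
  · have hmem : w ∉ F.filter (· < v) := by simp [hw]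
    rw [if_pos h, Finset.card_insert_of_notMem hmem, Finset.erase_eq_of_notMem (by simp [h.asymm]),
      pow_succ]
    ring

theorem chainBoundary_chainCone (v : Fin N) (z : Finset (Fin N) → K) (G : Finset (Fin N)) :
    chainBoundary (chainCone v z) G + chainCone v (chainBoundary z) G = z G := by
  simp only [chainBoundary, chainCone]
  by_cases hv : v ∈ G
  · have hc : (G.erase v)ᶜ = insert v Gᶜ := by
      ext w
      simp only [Finset.mem_compl, Finset.mem_erase, Finset.mem_insert]
      tauto
    rw [if_pos hv, hc, Finset.sum_insert (by simp [hv]), mul_add, Finset.insert_erase hv,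
      vertexSign_erase_self, ← mul_assoc, vertexSign_mul_self, one_mul, add_left_comm,
      Finset.mul_sum, ← Finset.sum_add_distrib, Finset.sum_eq_zero, add_zero]
    intro w hw
    have hw : w ∉ G := by simpa using hw
    have hvw : v ≠ w := fun h => hw (h ▸ hv)
    rw [if_pos (by simp [hv]), Finset.erase_insert_of_ne hvw.symm, ← mul_assoc,
      vertexSign_mul_insert hvw hv hw]
    ring
  · rw [if_neg hv, add_zero, Finset.sum_eq_single v]
    · rw [if_pos (by simp), vertexSign_insert_self, Finset.erase_insert hv, ← mul_assoc,
        vertexSign_mul_self, one_mul]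
    · intro w _ hwv
      rw [if_neg (by simp [hv, hwv.symm]), mul_zero]
    · intro h
      simp [hv] at h

theorem chainBoundary_add (y z : Finset (Fin N) → K) :
    chainBoundary (y + z) = chainBoundary y + chainBoundary z := by
  funext G
  simp [chainBoundary, mul_add, Finset.sum_add_distrib]

theorem chainBoundary_sub (y z : Finset (Fin N) → K) :
    chainBoundary (y - z) = chainBoundary y - chainBoundary z := by
  funext G
  simp [chainBoundary, mul_sub, Finset.sum_sub_distrib]

theorem chainCone_zero (v : Fin N) : chainCone v (0 : Finset (Fin N) → K) = 0 := by
  funext G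
  simp [chainCone]

theorem chainBoundary_chainCone_eq (v : Fin N) (z : Finset (Fin N) → K) :
    chainBoundary (chainCone v z) = z - chainCone v (chainBoundary z) :=
  eq_sub_of_add_eq (funext (chainBoundary_chainCone v z))

/-- Every cycle supported on the faces of cardinality `m` of `P` bounds a chain supported on the
faces of cardinality `m + 1`. -/
def CyclesBound (K : Type*) [Field K] {N : ℕ} (P : Finset (Fin N) → Prop) (m : ℕ) : Prop :=
  ∀ z : Finset (Fin N) → K, (∀ F, z F ≠ 0 → P F ∧ F.card = m) → chainBoundary z = 0 →
    ∃ y : Finset (Fin N) → K, (∀ F, y F ≠ 0 → P F ∧ F.card = m + 1) ∧ chainBoundary y = z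

/-- If cycles bound in the deletion and in the link of a vertex, they bound in the complex. -/
theorem CyclesBound.of_deletion_of_link {P D L : Finset (Fin N) → Prop} {m : ℕ} (v : Fin N)
    (hPD : ∀ F, P F → v ∉ F → D F) (hDP : ∀ F, D F → P F ∧ v ∉ F)
    (hPL : ∀ F, P F → v ∈ F → L (F.erase v))
    (hLP : ∀ F, L F → v ∉ F ∧ D F ∧ P (insert v F))
    (hD : CyclesBound K D (m + 1)) (hL : CyclesBound K L m) : CyclesBound K P (m + 1) := by
  intro z hz hz0
  set z₀ : Finset (Fin N) → K := fun F => if v ∈ F then 0 else z F with hz₀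
  set z₁ : Finset (Fin N) → K :=
    fun F => if v ∈ F then 0 else vertexSign K v F * z (insert v F) with hz₁
  have hsplit : z = z₀ + chainCone v z₁ := by
    funext F
    by_cases hv : v ∈ F
    · simp [hz₀, hz₁, chainCone, hv, vertexSign_erase_self, ← mul_assoc, vertexSign_mul_self]
    · simp [hz₀, chainCone, hv]
  have hz₁0 : chainBoundary z₁ = 0 := by
    funext G
    by_cases hv : v ∈ G
    · exact Finset.sum_eq_zero fun w _ => by simp [hz₁, hv]
    · have h := congrFun hz0 (insert v G)
      rw [hsplit, chainBoundary_add, chainBoundary_chainCone_eq] at h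
      have h₀ : chainBoundary z₀ (insert v G) = 0 :=
        Finset.sum_eq_zero fun w _ => by simp [hz₀]
      have h₁ : z₁ (insert v G) = 0 := by simp [hz₁]
      have h₂ : chainCone v (chainBoundary z₁) (insert v G) =
          vertexSign K v G * chainBoundary z₁ G := by
        simp [chainCone, vertexSign_insert_self, Finset.erase_insert hv]
      simp only [Pi.add_apply, Pi.sub_apply, h₀, h₁, h₂, Pi.zero_apply] at h
      have h : vertexSign K v G * chainBoundary z₁ G = 0 := by linear_combination -h
      calc chainBoundary z₁ G = vertexSign K v G * (vertexSign K v G * chainBoundary z₁ G) := by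
            rw [← mul_assoc, vertexSign_mul_self, one_mul]
        _ = 0 := by rw [h, mul_zero]
  obtain ⟨y₁, hy₁, hy₁z⟩ := hL z₁ (fun F hF => by
    have hv : v ∉ F := fun hv => hF (by simp [hz₁, hv])
    have hzF : z (insert v F) ≠ 0 := fun h => hF (by simp [hz₁, h])
    obtain ⟨hP, hcard⟩ := hz _ hzF
    have := hPL _ hP (Finset.mem_insert_self v F)
    rw [Finset.erase_insert hv] at this
    rw [Finset.card_insert_of_notMem hv] at hcard
    exact ⟨this, by omega⟩) hz₁0
  have hcone : chainBoundary (chainCone v y₁) = y₁ - chainCone v z₁ := by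
    rw [chainBoundary_chainCone_eq, hy₁z]
  have hdecomp : z₀ + y₁ = z + chainBoundary (chainCone v y₁) := by
    rw [hcone, hsplit]
    abel
  have hcycle : chainBoundary (z₀ + y₁) = 0 := by
    rw [hdecomp, chainBoundary_add, hz0, hcone, chainBoundary_sub, hy₁z,
      chainBoundary_chainCone_eq, hz₁0, chainCone_zero]
    abel
  obtain ⟨y₀, hy₀, hy₀z⟩ := hD (z₀ + y₁) (fun F hF => by
    by_cases h : z₀ F = 0
    · have : y₁ F ≠ 0 := fun h' => hF (by simp [h, h'])
      exact ⟨(hLP F (hy₁ F this).1).2.1, (hy₁ F this).2⟩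
    · have hv : v ∉ F := fun hv => h (by simp [hz₀, hv])
      have hzF : z F ≠ 0 := by simpa [hz₀, hv] using h
      exact ⟨hPD F (hz F hzF).1 hv, (hz F hzF).2⟩) hcycle
  refine ⟨y₀ - chainCone v y₁, fun F hF => ?_, ?_⟩
  · by_cases h : y₀ F = 0
    · have hc : chainCone v y₁ F ≠ 0 := fun h' => hF (by simp [h, h'])
      have hv : v ∈ F := by
        by_contra hv
        exact hc (by simp [chainCone, hv])
      have hy : y₁ (F.erase v) ≠ 0 := fun h' => hc (by simp [chainCone, h'])
      obtain ⟨hLF, hcard⟩ := hy₁ _ hy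
      have hP := (hLP _ hLF).2.2
      rw [Finset.insert_erase hv] at hP
      exact ⟨hP, by rw [← Finset.card_erase_add_one hv, hcard]⟩
    · exact ⟨(hDP F (hy₀ F h).1).1, (hy₀ F h).2⟩
  · rw [chainBoundary_sub, hy₀z, hdecomp]
    abel

/-- Cycles bound in a cone, and cycles of cardinality zero bound if there is a vertex. -/
theorem CyclesBound.of_insert {P : Finset (Fin N) → Prop} {m : ℕ} (v : Fin N)
    (h : ∀ F, P F → F.card = m → v ∉ F → P (insert v F)) : CyclesBound K P m := by
  intro z hz hz0
  refine ⟨chainCone v z, fun F hF => ?_, ?_⟩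
  · have hv : v ∈ F := by
      by_contra hv
      exact hF (by simp [chainCone, hv])
    obtain ⟨hP, hcard⟩ := hz (F.erase v) fun h' => hF (by simp [chainCone, h'])
    have hP := h _ hP hcard (Finset.notMem_erase v F)
    rw [Finset.insert_erase hv] at hP
    exact ⟨hP, by rw [← Finset.card_erase_add_one hv, hcard]⟩
  · rw [chainBoundary_chainCone_eq, hz0, chainCone_zero, sub_zero]

open scoped Classical in
theorem SplittingBound.cyclesBound {G : SimpleGraph (Fin N)} {W : Finset (Fin N)} {c m : ℕ}
    (h : SplittingBound G W c) (hm : c + m < W.card) :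
    CyclesBound K (fun F => (∀ u ∈ F, ∀ w ∈ F, ¬ G.Adj u w) ∧ F ⊆ W) m := by
  induction h generalizing m with
  | @edgeless W c h =>
    obtain ⟨v, hv⟩ : W.Nonempty := Finset.card_pos.1 (by omega)
    refine .of_insert v fun F hF _ _ => ?_
    have hs := Finset.insert_subset hv hF.2
    exact ⟨fun u hu w hw => h u (hs hu) w (hs hw), hs⟩
  | @split W v a b c h₁ h₂ ha hb ih₁ ih₂ =>
    by_cases hv : v ∈ W
    · cases m with
      | zero =>
        refine .of_insert v fun F hF hF0 _ => ?_
        rw [Finset.card_eq_zero.1 hF0]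
        simp [hv]
      | succ m =>
        have hdel := Finset.card_erase_add_one hv
        have hcard : W.card ≤ (W.filter fun w => w ≠ v ∧ ¬ G.Adj v w).card +
            (W.filter (G.Adj v)).card + 1 := by
          have : W ⊆ insert v ((W.filter fun w => w ≠ v ∧ ¬ G.Adj v w) ∪ W.filter (G.Adj v)) := by
            intro w hw
            simp only [Finset.mem_insert, Finset.mem_union, Finset.mem_filter]
            tauto
          refine (Finset.card_le_card this).trans ((Finset.card_insert_le _ _).trans ?_)
          exact Nat.add_le_add_right (Finset.card_union_le _ _) 1
        have hb : b + (W.filter (G.Adj v)).card ≤ c := by convert hb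
        refine .of_deletion_of_link v ?_ ?_ ?_ ?_ (ih₁ (m := m + 1) ?_) (ih₂ (m := m) ?_)
        · rintro F ⟨hF, hFW⟩ hvF
          refine ⟨hF, fun w hw => ?_⟩
          simp only [Finset.mem_erase]
          exact ⟨fun h => hvF (h ▸ hw), hFW hw⟩
        · rintro F ⟨hF, hFW⟩
          refine ⟨⟨hF, hFW.trans ?_⟩, fun hvF => by simpa using hFW hvF⟩
          intro w
          simp only [Finset.mem_erase]
          tauto
        · rintro F ⟨hF, hFW⟩ hvF
          refine ⟨fun u hu w hw => hF u (Finset.mem_of_mem_erase hu) w (Finset.mem_of_mem_erase hw),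
            fun w hw => ?_⟩
          rw [Finset.mem_erase] at hw
          simp only [Finset.mem_filter]
          exact ⟨hFW hw.2, hw.1, hF v hvF w hw.2⟩
        · rintro F ⟨hF, hFW⟩
          have hFW' : ∀ w ∈ F, w ∈ W ∧ w ≠ v ∧ ¬ G.Adj v w := fun w hw => by
            simpa only [Finset.mem_filter] using hFW hw
          refine ⟨fun hvF => (hFW' v hvF).2.1 rfl, ⟨hF, fun w hw => ?_⟩, ?_, ?_⟩
          · simp only [Finset.mem_erase]
            exact ⟨(hFW' w hw).2.1, (hFW' w hw).1⟩
          · intro u hu w hw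
            rw [Finset.mem_insert] at hu hw
            rcases hu with rfl | hu <;> rcases hw with rfl | hw
            · exact G.irrefl
            · exact (hFW' w hw).2.2
            · exact fun h => (hFW' u hu).2.2 h.symm
            · exact hF u hu w hw
          · exact Finset.insert_subset hv fun w hw => (hFW' w hw).1
        · convert (show a + (m + 1) < (W.erase v).card by omega)
        · convert (show b + m < (W.filter fun w => w ≠ v ∧ ¬ G.Adj v w).card by omega)
    · rw [@Finset.erase_eq_of_notMem _ (fun a b => Classical.propDecidable (a = b)) _ _ hv] at ih₁
      exact ih₁ (by omega)

theorem sum_bcoeff_mul (z : Finset (Fin N) → K) (G : Finset (Fin N)) :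
    ∑ F : Finset (Fin N), bcoeff K F G * z F = chainBoundary z G := by
  have h : ∀ F : Finset (Fin N), bcoeff K F G * z F =
      ∑ v : Fin N, if v ∈ F ∧ F.erase v = G then vertexSign K v F * z F else 0 := by
    intro F
    rw [bcoeff, Finset.sum_mul, ← Finset.sum_filter_add_sum_filter_not Finset.univ (· ∈ F),
      Finset.sum_eq_zero (s := Finset.univ.filter (· ∉ F)) (by simp +contextual), add_zero,
      Finset.filter_univ_mem]
    refine Finset.sum_congr rfl fun v hv => ?_
    simp [hv, vertexSign]
  simp only [h, chainBoundary]
  rw [Finset.sum_comm, ← Finset.sum_subset (Finset.subset_univ Gᶜ)]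
  · refine Finset.sum_congr rfl fun v hv => ?_
    have hv : v ∉ G := by simpa using hv
    rw [Finset.sum_eq_single (insert v G)]
    · simp [Finset.erase_insert hv, vertexSign_insert_self]
    · intro F _ hF
      refine if_neg fun h => hF ?_
      rw [← h.2, Finset.insert_erase h.1]
    · simp
  · intro v _ hv
    refine Finset.sum_eq_zero fun F _ => if_neg fun h => hv ?_
    rw [← h.2]
    simp

theorem boundaryMap_apply (Δ : Finset (Finset (Fin N))) (m : ℕ)
    (x : {F // F ∈ cfaces Δ (m + 1)} → K) {z : Finset (Fin N) → K}
    (hx : ∀ F, x F = z F) (hz : ∀ F, z F ≠ 0 → F ∈ cfaces Δ (m + 1)) (G) :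
    boundaryMap K Δ m x G = chainBoundary z G := by
  rw [← sum_bcoeff_mul]
  have h : boundaryMap K Δ m x G =
      ∑ F : {F // F ∈ cfaces Δ (m + 1)}, bcoeff K F.1 G * z F := by
    simp [boundaryMap, hx]
  rw [h, Finset.sum_coe_sort (cfaces Δ (m + 1)) (fun F => bcoeff K F G * z F)]
  refine Finset.sum_subset (Finset.subset_univ _) fun F _ hF => ?_
  rw [not_imp_comm.1 (hz F) hF, mul_zero]

theorem CyclesBound.mem_range_boundaryMap {Δ : Finset (Finset (Fin N))} {m : ℕ}
    (h : CyclesBound K (· ∈ Δ) m) {x : {F // F ∈ cfaces Δ m} → K} {z : Finset (Fin N) → K}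
    (hx : ∀ F, x F = z F) (hz : ∀ F, z F ≠ 0 → F ∈ cfaces Δ m) (hz0 : chainBoundary z = 0) :
    x ∈ LinearMap.range (boundaryMap K Δ m) := by
  obtain ⟨y, hy, rfl⟩ := h z (fun F hF => by simpa [cfaces] using hz F hF) hz0
  refine ⟨fun F => y F, funext fun G => ?_⟩
  rw [hx, boundaryMap_apply Δ m _ (fun _ => rfl) fun F hF => by simpa [cfaces] using hy F hF]

theorem reducedHomologyRank_eq_zero {Δ : Finset (Finset (Fin N))}
    (hΔ : ∀ F ∈ Δ, ∀ G ⊆ F, G ∈ Δ) {m : ℕ} (h : CyclesBound K (· ∈ Δ) m) :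
    reducedHomologyRank K Δ ((m : ℤ) - 1) = 0 := by
  have hext : ∀ x : {F // F ∈ cfaces Δ m} → K, ∃ z : Finset (Fin N) → K,
      (∀ F, x F = z F) ∧ ∀ F, z F ≠ 0 → F ∈ cfaces Δ m := by
    intro x
    refine ⟨fun F => if hF : F ∈ cfaces Δ m then x ⟨F, hF⟩ else 0, fun F => by simp, fun F hF => ?_⟩
    by_contra hF'
    exact hF (dif_neg hF')
  cases m with
  | zero =>
    have htop : LinearMap.range (boundaryMap K Δ 0) = ⊤ := by
      refine eq_top_iff.2 fun x _ => ?_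
      obtain ⟨z, hx, hz⟩ := hext x
      refine h.mem_range_boundaryMap hx hz (funext fun G => Finset.sum_eq_zero fun w _ => ?_)
      rw [not_imp_comm.1 (hz _) (by simp [cfaces]), mul_zero]
    rw [reducedHomologyRank, if_pos (by simp), htop]
    exact Module.finrank_zero_of_subsingleton
  | succ m =>
    have hm : ((m + 1 : ℕ) : ℤ) - 1 = m := by push_cast; ring
    rw [hm, reducedHomologyRank, if_neg (by omega), if_pos (by omega), Int.toNat_natCast]
    have htop : Submodule.comap (LinearMap.ker (boundaryMap K Δ m)).subtype
        (LinearMap.range (boundaryMap K Δ (m + 1))) = ⊤ := by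
      refine eq_top_iff.2 fun x _ => ?_
      obtain ⟨z, hx, hz⟩ := hext x
      refine h.mem_range_boundaryMap hx hz (funext fun G => ?_)
      by_cases hG : G ∈ cfaces Δ m
      · rw [← boundaryMap_apply Δ m x.1 hx hz ⟨G, hG⟩, LinearMap.mem_ker.1 x.2]
        rfl
      · refine Finset.sum_eq_zero fun w hw => ?_
        have hw : w ∉ G := by simpa using hw
        rw [not_imp_comm.1 (hz _) fun hF => hG ?_, mul_zero]
        simp only [cfaces, Finset.mem_filter] at hF ⊢
        rw [Finset.card_insert_of_notMem hw] at hF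
        exact ⟨hΔ _ hF.1 _ (Finset.subset_insert _ _), by omega⟩
    rw [htop]
    exact Module.finrank_zero_of_subsingleton

theorem pdEdgeIdeal_le {V : Type*} [Fintype V] {G : SimpleGraph V} {c : ℕ}
    (h : SplittingBound G Finset.univ c) : pdEdgeIdeal K G ≤ c - 1 := by
  refine csSup_le' ?_
  rintro i ⟨j, hij⟩
  by_contra! hi
  obtain ⟨W, hW, hrank⟩ := Finset.exists_ne_zero_of_sum_ne_zero hij
  have hcard := (Finset.mem_powersetCard.1 hW).2
  rcases le_or_gt (i + 1) j with hle | hlt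
  · obtain ⟨m, rfl⟩ := Nat.exists_eq_add_of_le hle
    have hm : ((i + 1 + m : ℕ) : ℤ) - i - 2 = m - 1 := by push_cast; ring
    rw [hm] at hrank
    refine hrank (reducedHomologyRank_eq_zero ?_ ?_)
    · intro F hF F' hF'
      simp only [indComplex, Finset.mem_filter, Finset.mem_univ, true_and] at hF ⊢
      exact ⟨fun u hu w hw => hF.1 u (hF' hu) w (hF' hw), hF'.trans hF.2⟩
    · have hc := (h.comap_equiv (Fintype.equivFin V).symm W (by simp)).cyclesBound (K := K) (m := m)
        (by omega)
      convert hc using 2 with F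
      simp [indComplex]
  · refine hrank ?_
    rw [reducedHomologyRank, if_neg (by omega), if_neg (by omega)]

end ReducedHomology

section MoebiusLadder

theorem circulant_adj_natCast {n : ℕ} {i j s : ℕ} (hs : s = 1 ∨ s = n) (hij : j = i + s)
    (hs0 : 0 < s) (hsn : s < 2 * n) : (circulant (2 * n) {1, n}).Adj i j := by
  have hne : (s : ZMod (2 * n)) ≠ 0 := by
    rw [Ne, ZMod.natCast_eq_zero_iff]
    exact Nat.not_dvd_of_pos_of_lt hs0 hsn
  rw [circulant, SimpleGraph.fromRel_adj]
  subst hij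
  refine ⟨fun h => hne ?_, Or.inl ⟨s, by simpa using hs, by push_cast; ring⟩⟩
  push_cast at h
  simpa using h.symm

theorem circulant_le {n : ℕ} [NeZero n] {H : SimpleGraph (ZMod (2 * n))}
    (h₁ : ∀ i < n, H.Adj (i : ℕ) (i + 1 : ℕ)) (h₂ : ∀ i < n, H.Adj (n + i : ℕ) (n + i + 1 : ℕ))
    (h₃ : ∀ i < n, H.Adj (i : ℕ) (n + i : ℕ)) : circulant (2 * n) {1, n} ≤ H := by
  have key : ∀ a b : ZMod (2 * n), (∃ s ∈ ({1, n} : Set ℕ), b - a = (s : ZMod (2 * n))) →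
      H.Adj a b := by
    rintro a b ⟨s, hs, hab⟩
    obtain ⟨i, hi, rfl⟩ : ∃ i < 2 * n, (i : ZMod (2 * n)) = a :=
      ⟨a.val, ZMod.val_lt a, ZMod.natCast_zmod_val a⟩
    obtain rfl : b = ((i + s : ℕ) : ZMod (2 * n)) := by
      rw [sub_eq_iff_eq_add] at hab
      rw [hab]
      push_cast
      ring
    rcases lt_or_ge i n with hin | hin
    · rcases hs with rfl | rfl
      · exact h₁ i hin
      · rw [add_comm]
        exact h₃ i hin
    · obtain ⟨i, rfl⟩ := Nat.exists_eq_add_of_le hin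
      rcases hs with rfl | rfl
      · exact h₂ i (by omega)
      · have h := (h₃ i (by omega)).symm
        have e : ((s + i + s : ℕ) : ZMod (2 * s)) = (i : ℕ) := by
          rw [show s + i + s = 2 * s + i by ring, Nat.cast_add, ZMod.natCast_self, zero_add]
        rwa [e]
  intro a b hab
  rw [circulant, SimpleGraph.fromRel_adj] at hab
  exact hab.2.elim (key a b) fun h => (key b a h).symm

theorem nodup_map_natCast {n j : ℕ} {l : List ℕ} (hl : l.Nodup) (hlt : ∀ c ∈ l, c < 2 * n) :
    (l.map fun c => ((c + j : ℕ) : ZMod (2 * n))).Nodup := by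
  refine hl.map_on fun c hc d hd h => ?_
  rw [ZMod.natCast_eq_natCast_iff] at h
  exact (Nat.ModEq.add_right_cancel' j h).eq_of_lt_of_lt (hlt c hc) (hlt d hd)

/-- The subgraph of the Möbius ladder consisting of the rungs at `i` and `i + 1` and the rails
between `i` and `i + 2`. -/
def ladderBlock (n i : ℕ) : SimpleGraph (ZMod (2 * n)) :=
  SimpleGraph.fromEdgeSet
    {s(((0 + i : ℕ) : ZMod (2 * n)), ((1 + i : ℕ) : ZMod (2 * n))),
      s(((1 + i : ℕ) : ZMod (2 * n)), ((2 + i : ℕ) : ZMod (2 * n))),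
      s(((n + i : ℕ) : ZMod (2 * n)), ((n + 1 + i : ℕ) : ZMod (2 * n))),
      s(((n + 1 + i : ℕ) : ZMod (2 * n)), ((n + 2 + i : ℕ) : ZMod (2 * n))),
      s(((0 + i : ℕ) : ZMod (2 * n)), ((n + i : ℕ) : ZMod (2 * n))),
      s(((1 + i : ℕ) : ZMod (2 * n)), ((n + 1 + i : ℕ) : ZMod (2 * n)))}

/-- The subgraph of the Möbius ladder consisting of the rung at `i` and the rails between `i` and
`i + 1`. -/
def ladderEnd (n i : ℕ) : SimpleGraph (ZMod (2 * n)) :=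
  SimpleGraph.fromEdgeSet
    {s(((0 + i : ℕ) : ZMod (2 * n)), ((1 + i : ℕ) : ZMod (2 * n))),
      s(((n + i : ℕ) : ZMod (2 * n)), ((n + 1 + i : ℕ) : ZMod (2 * n))),
      s(((0 + i : ℕ) : ZMod (2 * n)), ((n + i : ℕ) : ZMod (2 * n)))}

variable {n : ℕ}

theorem splittingBound_ladderBlock (hn : 3 ≤ n) (i : ℕ) (W : Finset (ZMod (2 * n))) :
    SplittingBound (ladderBlock n i) W 3 :=
  .squareWithTails (nodup_map_natCast (l := [0, 1, 2, n, n + 1, n + 2])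
    (by simp; omega) (by simp; omega)) W

theorem splittingBound_ladderEnd (hn : 3 ≤ n) (i : ℕ) (W : Finset (ZMod (2 * n))) :
    SplittingBound (ladderEnd n i) W 2 :=
  .path (nodup_map_natCast (l := [0, 1, n, n + 1]) (by simp; omega) (by simp; omega)) W

theorem ladderBlock_le_circulant (hn : 3 ≤ n) (i : ℕ) :
    ladderBlock n i ≤ circulant (2 * n) {1, n} := by
  intro a b hab
  simp only [ladderBlock, SimpleGraph.fromEdgeSet_adj, Set.mem_insert_iff,
    Set.mem_singleton_iff] at hab
  rw [← SimpleGraph.mem_edgeSet]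
  rcases hab.1 with h | h | h | h | h | h <;> rw [h, SimpleGraph.mem_edgeSet]
  · exact circulant_adj_natCast (s := 1) (by simp) (by ring) (by omega) (by omega)
  · exact circulant_adj_natCast (s := 1) (by simp) (by ring) (by omega) (by omega)
  · exact circulant_adj_natCast (s := 1) (by simp) (by ring) (by omega) (by omega)
  · exact circulant_adj_natCast (s := 1) (by simp) (by ring) (by omega) (by omega)
  · exact circulant_adj_natCast (s := n) (by simp) (by ring) (by omega) (by omega)
  · exact circulant_adj_natCast (s := n) (by simp) (by ring) (by omega) (by omega)

theorem ladderEnd_le_circulant (hn : 3 ≤ n) (i : ℕ) :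
    ladderEnd n i ≤ circulant (2 * n) {1, n} := by
  intro a b hab
  simp only [ladderEnd, SimpleGraph.fromEdgeSet_adj, Set.mem_insert_iff,
    Set.mem_singleton_iff] at hab
  rw [← SimpleGraph.mem_edgeSet]
  rcases hab.1 with h | h | h <;> rw [h, SimpleGraph.mem_edgeSet]
  · exact circulant_adj_natCast (s := 1) (by simp) (by ring) (by omega) (by omega)
  · exact circulant_adj_natCast (s := 1) (by simp) (by ring) (by omega) (by omega)
  · exact circulant_adj_natCast (s := n) (by simp) (by ring) (by omega) (by omega)

theorem adj_of_le_of_mem {V : Type*} {G H : SimpleGraph V} {S : Set (Sym2 V)} {a b : V}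
    (hle : SimpleGraph.fromEdgeSet S ≤ H) (hab : G.Adj a b) (h : s(a, b) ∈ S) : H.Adj a b :=
  hle (by simpa [SimpleGraph.fromEdgeSet_adj] using ⟨h, hab.ne⟩)

/-- A graph containing the block at `2j` contains all the edges of the Möbius ladder starting at
the indices `2j` and `2j + 1`. -/
theorem adj_of_ladderBlock_le {H : SimpleGraph (ZMod (2 * n))} (hn : 3 ≤ n) {j i : ℕ}
    (hle : ladderBlock n (2 * j) ≤ H) (hi : i = 2 * j ∨ i = 2 * j + 1) :
    H.Adj (i : ℕ) (i + 1 : ℕ) ∧ H.Adj (n + i : ℕ) (n + i + 1 : ℕ) ∧ H.Adj (i : ℕ) (n + i : ℕ) := by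
  refine ⟨adj_of_le_of_mem hle (circulant_adj_natCast (s := 1) (by simp) (by ring) (by omega)
      (by omega)) ?_, adj_of_le_of_mem hle (circulant_adj_natCast (s := 1) (by simp) (by ring)
      (by omega) (by omega)) ?_, adj_of_le_of_mem hle (circulant_adj_natCast (s := n) (by simp)
      (by ring) (by omega) (by omega)) ?_⟩ <;>
  · have e₁ : 2 * j + 1 = 1 + 2 * j := by ring
    have e₂ : 1 + 2 * j + 1 = 2 + 2 * j := by ring
    have e₃ : n + 2 * j + 1 = n + 1 + 2 * j := by ring
    have e₄ : n + (1 + 2 * j) = n + 1 + 2 * j := by ring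
    have e₅ : n + 1 + 2 * j + 1 = n + 2 + 2 * j := by ring
    rcases hi with rfl | rfl <;>
    simp only [e₁, e₂, e₃, e₄, e₅, zero_add, Set.mem_insert_iff, Set.mem_singleton_iff,
      true_or, or_true]

theorem adj_of_ladderEnd_le {H : SimpleGraph (ZMod (2 * n))} (hn : 3 ≤ n) {i : ℕ}
    (hle : ladderEnd n i ≤ H) :
    H.Adj (i : ℕ) (i + 1 : ℕ) ∧ H.Adj (n + i : ℕ) (n + i + 1 : ℕ) ∧ H.Adj (i : ℕ) (n + i : ℕ) := by
  refine ⟨adj_of_le_of_mem hle (circulant_adj_natCast (s := 1) (by simp) (by ring) (by omega)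
      (by omega)) ?_, adj_of_le_of_mem hle (circulant_adj_natCast (s := 1) (by simp) (by ring)
      (by omega) (by omega)) ?_, adj_of_le_of_mem hle (circulant_adj_natCast (s := n) (by simp)
      (by ring) (by omega) (by omega)) ?_⟩ <;>
  · have e₁ : 1 + i = i + 1 := by ring
    have e₂ : n + 1 + i = n + i + 1 := by ring
    simp only [e₁, e₂, zero_add, Set.mem_insert_iff, Set.mem_singleton_iff, true_or, or_true]

theorem adj_of_iSup_ladderBlock_le {H : SimpleGraph (ZMod (2 * n))} (hn : 3 ≤ n) {k i : ℕ}
    (hle : ⨆ j : ℕ, ⨆ _ : j < k, ladderBlock n (2 * j) ≤ H) (hi : i < 2 * k) :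
    H.Adj (i : ℕ) (i + 1 : ℕ) ∧ H.Adj (n + i : ℕ) (n + i + 1 : ℕ) ∧ H.Adj (i : ℕ) (n + i : ℕ) :=
  adj_of_ladderBlock_le hn (j := i / 2) ((le_iSup₂_of_le (i / 2) (by omega) le_rfl).trans hle)
    (by omega)

theorem iSup_ladderBlock_le_circulant (hn : 3 ≤ n) (k : ℕ) :
    ⨆ j : ℕ, ⨆ _ : j < k, ladderBlock n (2 * j) ≤ circulant (2 * n) {1, n} :=
  iSup₂_le fun _ _ => ladderBlock_le_circulant hn _

theorem circulant_eq_iSup_ladderBlock {k : ℕ} [NeZero n] (hn : 3 ≤ n) (hk : n = 2 * k) :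
    circulant (2 * n) {1, n} = ⨆ j : ℕ, ⨆ _ : j < k, ladderBlock n (2 * j) := by
  have h : ∀ i < n, _ := fun i hi => adj_of_iSup_ladderBlock_le (n := n) hn (k := k) le_rfl
    (i := i) (by omega)
  exact le_antisymm (circulant_le (fun i hi => (h i hi).1) (fun i hi => (h i hi).2.1)
    fun i hi => (h i hi).2.2) (iSup_ladderBlock_le_circulant hn k)

theorem circulant_eq_iSup_ladderBlock_sup_ladderEnd {k : ℕ} [NeZero n] (hn : 3 ≤ n)
    (hk : n = 2 * k + 1) : circulant (2 * n) {1, n} =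
      (⨆ j : ℕ, ⨆ _ : j < k, ladderBlock n (2 * j)) ⊔ ladderEnd n (2 * k) := by
  set H := (⨆ j : ℕ, ⨆ _ : j < k, ladderBlock n (2 * j)) ⊔ ladderEnd n (2 * k) with hH
  have h : ∀ i < n, H.Adj (i : ℕ) (i + 1 : ℕ) ∧ H.Adj (n + i : ℕ) (n + i + 1 : ℕ) ∧
      H.Adj (i : ℕ) (n + i : ℕ) := by
    intro i hi
    rcases Nat.lt_or_ge i (2 * k) with hik | hik
    · exact adj_of_iSup_ladderBlock_le hn le_sup_left hik
    · obtain rfl : i = 2 * k := by omega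
      exact adj_of_ladderEnd_le hn le_sup_right
  exact le_antisymm (circulant_le (fun i hi => (h i hi).1) (fun i hi => (h i hi).2.1)
    fun i hi => (h i hi).2.2)
    (sup_le (iSup_ladderBlock_le_circulant hn k) (ladderEnd_le_circulant hn _))

end MoebiusLadder

/-- **Lemma 4.3(i).**
Let `n ≥ 4` and let `G = C_{2n}(1, n)` be the cubic circulant graph on `2n`
vertices with connection set `{1, n}`.  Then `pd(I(G)) ≤ 3k - 1` if `n = 2k`,
and `pd(I(G)) ≤ 3k + 1` if `n = 2k + 1`. -/
theorem projective_dimension_bound_C2n_1_n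
    (K : Type*) [Field K] (n : ℕ) [NeZero n] (hn : 4 ≤ n) :
    (∀ k : ℕ, n = 2 * k →
      pdEdgeIdeal K (circulant (2 * n) {1, n}) ≤ 3 * k - 1) ∧
    (∀ k : ℕ, n = 2 * k + 1 →
      pdEdgeIdeal K (circulant (2 * n) {1, n}) ≤ 3 * k + 1) := by
  have hn : 3 ≤ n := by omega
  have hblocks (k : ℕ) := SplittingBound.iSup_lt
    (fun j W => splittingBound_ladderBlock hn (2 * j) W) k (Finset.univ : Finset (ZMod (2 * n)))
  constructor
  · intro k hk
    refine pdEdgeIdeal_le ?_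
    rw [circulant_eq_iSup_ladderBlock hn hk]
    exact hblocks k
  · intro k hk
    refine pdEdgeIdeal_le (c := 3 * k + 2) ?_
    rw [circulant_eq_iSup_ladderBlock_sup_ladderEnd hn hk]
    exact (hblocks k).sup (splittingBound_ladderEnd hn (2 * k) Finset.univ)
end
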